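/- Fix an integer r ≥ 1 and let F = ℚ(q,t). Let Λ_r = F[p_{n,i} : n ≥ 1, i ∈ ℤ/rℤ] be the polynomial algebra, and let ⟨·,·⟩ be the F-bilinear Hall pairing on Λ_r for which the monomials p_m := Π_{n,i} p_{n,i}^{m_{n,i}} (m a finitely supported family of non-negative integers) are orthogonal with ⟨p_m, p_m⟩ = Π_{n,i} n^{m_{n,i}} · m_{n,i}!. Let ι be the F-algebra endomorphism of Λ_r with ι(p_{n,i}) = p_{n,−i}, and let Φ be the F-algebra endomorphism with Φ(p_{n,i}) = t^n p_{n,i+1} − (1 + q^n t^n) p_{n,i} + q^n p_{n,i−1} (this is the matrix plethysm g ↦ g[(1−qσ^{−1})(tσ−1)X]). Then the modified wreath Macdonald pairing ⟨f, g⟩' := ⟨ι(f), Φ(g)⟩ is symmetric: ⟨f, g⟩' = ⟨g, f⟩' for all f, g ∈ Λ_r. -/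

import Mathlib

open MvPolynomial

/-- The field `F = ℚ(q,t)` of rational functions in two variables. -/
abbrev FF : Type := FractionRing (MvPolynomial (Fin 2) ℚ)

/-- The variable `q ∈ ℚ(q,t)`. -/
noncomputable def qF : FF := algebraMap (MvPolynomial (Fin 2) ℚ) FF (X 0)

/-- The variable `t ∈ ℚ(q,t)`. -/
noncomputable def tF : FF := algebraMap (MvPolynomial (Fin 2) ℚ) FF (X 1)

/-- `Λ_r = F[p_{n,i} : n ≥ 1, i ∈ ℤ/rℤ]`, the ring of `r`-fold tensor
symmetric functions, presented as the polynomial algebra on colored power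
sums; the variable `(k, i)` represents `p_{k+1, i}`. -/
abbrev Lr (r : ℕ) : Type := MvPolynomial (ℕ × ZMod r) FF

/-- The Hall norm `z(m) = Π_{(n,i)} n^{m_{n,i}} · (m_{n,i})!` of a power-sum
monomial exponent `m`. -/
noncomputable def hallFactor {r : ℕ} (m : (ℕ × ZMod r) →₀ ℕ) : FF :=
  m.prod fun v e => (((v.1 + 1 : ℕ) : FF)) ^ e * (Nat.factorial e : FF)

/-- The Hall pairing on `Λ_r`: the `F`-bilinear form for which the power-sum
monomials `p_m = Π p_{n,i}^{m_{n,i}}` are orthogonal with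
`⟨p_m, p_m⟩ = Π_{n,i} n^{m_{n,i}} (m_{n,i})!`. -/
noncomputable def hallPairing {r : ℕ} (f g : Lr r) : FF :=
  ∑ m ∈ f.support, coeff m f * coeff m g * hallFactor m

/-- The involution `ι`, the `F`-algebra endomorphism with `ι(p_{n,i}) = p_{n,−i}`. -/
noncomputable def iotaMap (r : ℕ) : Lr r →ₐ[FF] Lr r :=
  aeval fun v : ℕ × ZMod r => X (v.1, -v.2)

/-- The matrix plethysm `g ↦ g[(1−qσ⁻¹)(tσ−1)X]`: the `F`-algebra
endomorphism with
`Φ(p_{n,i}) = t^n p_{n,i+1} − (1 + q^n t^n) p_{n,i} + q^n p_{n,i−1}`. -/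
noncomputable def phiMap (r : ℕ) : Lr r →ₐ[FF] Lr r :=
  aeval fun v : ℕ × ZMod r =>
    C (tF ^ (v.1 + 1)) * X (v.1, v.2 + 1)
      - C (1 + qF ^ (v.1 + 1) * tF ^ (v.1 + 1)) * X (v.1, v.2)
      + C (qF ^ (v.1 + 1)) * X (v.1, v.2 - 1)

section HallPairing

variable {r : ℕ}

lemma hallPairing_eq_sum {f g : Lr r} {s : Finset ((ℕ × ZMod r) →₀ ℕ)} (h : f.support ⊆ s) :
    hallPairing f g = ∑ m ∈ s, coeff m f * coeff m g * hallFactor m :=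
  Finset.sum_subset h fun m _ hm => by simp [notMem_support_iff.mp hm]

lemma hallPairing_comm (f g : Lr r) : hallPairing f g = hallPairing g f := by
  classical
  rw [hallPairing_eq_sum (Finset.subset_union_left (s₂ := g.support)),
    hallPairing_eq_sum (Finset.subset_union_right (s₁ := f.support))]
  exact Finset.sum_congr rfl fun m _ => by ring

lemma hallPairing_add_right (f g g' : Lr r) :
    hallPairing f (g + g') = hallPairing f g + hallPairing f g' := by
  simp only [hallPairing, coeff_add, ← Finset.sum_add_distrib]
  exact Finset.sum_congr rfl fun m _ => by ring

lemma hallPairing_add_left (f f' g : Lr r) :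
    hallPairing (f + f') g = hallPairing f g + hallPairing f' g := by
  simp only [hallPairing_comm _ g, hallPairing_add_right]

lemma hallPairing_smul_right (c : FF) (f g : Lr r) :
    hallPairing f (c • g) = c * hallPairing f g := by
  simp only [hallPairing, coeff_smul, smul_eq_mul, Finset.mul_sum]
  exact Finset.sum_congr rfl fun m _ => by ring

lemma hallPairing_smul_left (c : FF) (f g : Lr r) :
    hallPairing (c • f) g = c * hallPairing f g := by
  rw [hallPairing_comm, hallPairing_smul_right, hallPairing_comm]

lemma hallPairing_C (a : FF) (g : Lr r) : hallPairing (C a) g = a * constantCoeff g := by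
  classical
  rw [hallPairing_eq_sum (s := {0})]
  · simp [hallFactor, constantCoeff_eq]
  · intro m hm
    by_contra h
    rw [mem_support_iff, coeff_C, if_neg (by simpa [eq_comm] using h)] at hm
    exact hm rfl

lemma hallFactor_add_single (m : (ℕ × ZMod r) →₀ ℕ) (v : ℕ × ZMod r) :
    hallFactor (m + Finsupp.single v 1) =
      hallFactor m * (((v.1 + 1 : ℕ) : FF) * ((m v : FF) + 1)) := by
  classical
  have h0 (i : ℕ × ZMod r) :
      (fun (v : ℕ × ZMod r) (e : ℕ) => ((v.1 + 1 : ℕ) : FF) ^ e * (e.factorial : FF)) i 0 = 1 := by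
    simp
  rw [hallFactor, hallFactor, ← Finsupp.mul_prod_erase' m v _ h0,
    ← Finsupp.mul_prod_erase' (m + Finsupp.single v 1) v _ h0]
  have he : (m + Finsupp.single v 1).erase v = m.erase v := by
    rw [Finsupp.erase_add, Finsupp.erase_single, add_zero]
  rw [he]
  simp only [Finsupp.add_apply, Finsupp.single_eq_same, pow_succ, Nat.factorial_succ]
  push_cast
  ring

lemma hallPairing_X_mul (v : ℕ × ZMod r) (f g : Lr r) :
    hallPairing (X v * f) g = hallPairing f (((v.1 + 1 : ℕ) : FF) • pderiv v g) := by
  rw [hallPairing, support_X_mul, Finset.sum_map, hallPairing]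
  refine Finset.sum_congr rfl fun m _ => ?_
  rw [addLeftEmbedding_apply, coeff_X_mul, add_comm, hallFactor_add_single, coeff_smul,
    coeff_pderiv, smul_eq_mul]
  ring

/-- A criterion for `T` to be adjoint to `S` with respect to the Hall pairing, where `D v` is the
derivation adjoint to multiplication by `S (X v)`. -/
lemma hallPairing_adjoint (S T : Lr r →ₐ[FF] Lr r)
    (D : ℕ × ZMod r → Derivation FF (Lr r) (Lr r))
    (hS : ∀ v f g, hallPairing (S (X v) * f) g = hallPairing f (D v g))
    (hT : ∀ v w, T (D v (X w)) = ((v.1 + 1 : ℕ) : FF) • pderiv v (T (X w)))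
    (hT0 : ∀ w, constantCoeff (T (X w)) = 0) (f g : Lr r) :
    hallPairing (S f) g = hallPairing f (T g) := by
  have hTD (v : ℕ × ZMod r) (g : Lr r) :
      T (D v g) = ((v.1 + 1 : ℕ) : FF) • pderiv v (T g) := by
    induction g using MvPolynomial.induction_on with
    | C a => simp [← algebraMap_eq]
    | add p q hp hq => simp only [map_add, hp, hq, smul_add]
    | mul_X p w hp =>
      simp only [Derivation.leibniz, smul_eq_mul, map_add, map_mul, hp, hT, smul_add,
        mul_smul_comm]
  have hTc (g : Lr r) : constantCoeff (T g) = constantCoeff g := by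
    induction g using MvPolynomial.induction_on with
    | C a => rw [← algebraMap_eq, AlgHom.commutes]
    | add p q hp hq => simp only [map_add, hp, hq]
    | mul_X p w hp => simp [hT0]
  induction f using MvPolynomial.induction_on generalizing g with
  | C a => rw [← algebraMap_eq, AlgHom.commutes, algebraMap_eq, hallPairing_C, hallPairing_C, hTc]
  | add p q hp hq => simp only [map_add, hallPairing_add_left, hp, hq]
  | mul_X p v hp => rw [map_mul, mul_comm, hS, hp, hTD, mul_comm, hallPairing_X_mul]

lemma hallPairing_iotaMap_left (f g : Lr r) :
    hallPairing (iotaMap r f) g = hallPairing f (iotaMap r g) := by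
  refine hallPairing_adjoint (iotaMap r) (iotaMap r)
    (fun v => ((v.1 + 1 : ℕ) : FF) • pderiv (v.1, -v.2)) ?_ ?_ ?_ f g
  · intro v f g
    rw [iotaMap, aeval_X, hallPairing_X_mul]
    rfl
  · rintro ⟨n, i⟩ ⟨k, j⟩
    classical
    simp only [iotaMap, aeval_X, Derivation.smul_apply, map_smul, pderiv_X, Pi.single_apply,
      Prod.mk.injEq, neg_eq_iff_eq_neg]
    split_ifs <;> simp
  · simp [iotaMap]

lemma phiMap_X (v : ℕ × ZMod r) :
    phiMap r (X v) = tF ^ (v.1 + 1) • X (v.1, v.2 + 1)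
      + (-(1 + qF ^ (v.1 + 1) * tF ^ (v.1 + 1))) • X (v.1, v.2)
      + qF ^ (v.1 + 1) • X (v.1, v.2 - 1) := by
  rw [phiMap, aeval_X, C_mul', C_mul', C_mul', neg_smul, sub_eq_add_neg]

/-- The adjoint of `phiMap r` with respect to the Hall pairing, obtained from it by exchanging `σ`
and `σ⁻¹`. -/
noncomputable def phiAdjoint (r : ℕ) : Lr r →ₐ[FF] Lr r :=
  aeval fun v : ℕ × ZMod r =>
    tF ^ (v.1 + 1) • X (v.1, v.2 - 1)
      + (-(1 + qF ^ (v.1 + 1) * tF ^ (v.1 + 1))) • X (v.1, v.2)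
      + qF ^ (v.1 + 1) • X (v.1, v.2 + 1)

lemma hallPairing_phiMap_left (f g : Lr r) :
    hallPairing (phiMap r f) g = hallPairing f (phiAdjoint r g) := by
  refine hallPairing_adjoint (phiMap r) (phiAdjoint r)
    (fun v => ((v.1 + 1 : ℕ) : FF) • (tF ^ (v.1 + 1) • pderiv (v.1, v.2 + 1)
      + (-(1 + qF ^ (v.1 + 1) * tF ^ (v.1 + 1))) • pderiv (v.1, v.2)
      + qF ^ (v.1 + 1) • pderiv (v.1, v.2 - 1))) ?_ ?_ ?_ f g
  · intro v f g
    simp only [phiMap_X, add_mul, smul_mul_assoc, hallPairing_add_left, hallPairing_smul_left,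
      hallPairing_X_mul, Derivation.smul_apply, Derivation.add_apply,
      hallPairing_smul_right, hallPairing_add_right]
    ring
  · rintro ⟨n, i⟩ ⟨k, j⟩
    classical
    have h1 : j = i + 1 ↔ j - 1 = i := sub_eq_iff_eq_add.symm
    have h2 : j = i - 1 ↔ j + 1 = i := eq_sub_iff_add_eq
    simp only [phiAdjoint, aeval_X, Derivation.smul_apply, Derivation.add_apply, map_smul, map_add,
      Derivation.map_smul, pderiv_X, Pi.single_apply, Prod.mk.injEq, h1, h2]
    by_cases hk : k = n
    · simp only [hk, true_and, apply_ite (aeval _ : Lr r →ₐ[FF] Lr r), map_one, map_zero]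
    · simp [hk]
  · simp [phiAdjoint]

lemma iotaMap_phiMap (g : Lr r) : iotaMap r (phiMap r g) = phiAdjoint r (iotaMap r g) := by
  suffices h : (iotaMap r).comp (phiMap r) = (phiAdjoint r).comp (iotaMap r) from
    DFunLike.congr_fun h g
  ext1 ⟨n, i⟩
  have h1 : -(i + 1) = -i - 1 := by ring
  have h2 : -(i - 1) = -i + 1 := by ring
  simp only [AlgHom.comp_apply, phiMap_X, map_add, map_smul, iotaMap, phiAdjoint, aeval_X, h1, h2]

end HallPairing

/-- The modified wreath Macdonald pairing `⟨f, g⟩' = ⟨ι(f), Φ(g)⟩` is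
symmetric. -/
theorem wreath_macdonald_pairing_symmetric (r : ℕ) (hr : 1 ≤ r) (f g : Lr r) :
    hallPairing (iotaMap r f) (phiMap r g) = hallPairing (iotaMap r g) (phiMap r f) := by
  rw [hallPairing_iotaMap_left, iotaMap_phiMap, hallPairing_comm (iotaMap r g),
    hallPairing_phiMap_left]
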